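/- Roth's removal rule over a commutative ring: Let R be a commutative unital ring, A ∈ R^{n×n}, B ∈ R^{m×m}, C ∈ R^{n×m}. The block matrices [[A, 0],[0, B]] and [[A, C],[0, B]] are similar over R if and only if there exists X ∈ R^{n×m} with AX − XB = C. -/

import Mathlib

namespace Matrix

variable {R : Type*} [CommRing R] {n m : Type*} [Fintype n] [Fintype m]

/-- The Sylvester operator `X ↦ A * X - X * B`. -/
def sylvester (A : Matrix n n R) (B : Matrix m m R) : Matrix n m R →ₗ[R] Matrix n m R where
  toFun X := A * X - X * B
  map_add' X Y := by rw [Matrix.mul_add, Matrix.add_mul]; abel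
  map_smul' r X := by simp [smul_sub]

@[simp]
lemma sylvester_apply (A : Matrix n n R) (B : Matrix m m R) (X : Matrix n m R) :
    sylvester A B X = A * X - X * B := rfl

lemma mem_ker_sylvester {A : Matrix n n R} {B : Matrix m m R} {X : Matrix n m R} :
    X ∈ LinearMap.ker (sylvester A B) ↔ A * X = X * B := by
  simp [sub_eq_zero]

lemma fromRows_mem_ker_sylvester {A : Matrix n n R} {B : Matrix m m R} {C : Matrix n m R}
    {V : Matrix n m R} {Y : Matrix m m R} :
    fromRows V Y ∈ LinearMap.ker (sylvester (fromBlocks A C 0 B) B) ↔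
      A * V + C * Y = V * B ∧ B * Y = Y * B := by
  rw [mem_ker_sylvester, fromBlocks_mul_fromRows, fromRows_mul]
  simp [fromRows_inj.eq_iff]

/-- The upper rows inclusion between the kernels of Sylvester operators. -/
def kerSylvesterInl (A : Matrix n n R) (B : Matrix m m R) (C : Matrix n m R) :
    LinearMap.ker (sylvester A B) →ₗ[R]
      LinearMap.ker (sylvester (fromBlocks A C 0 B) B) where
  toFun V := ⟨fromRows V 0, fromRows_mem_ker_sylvester.2
    ⟨by simpa using mem_ker_sylvester.1 V.2, by simp⟩⟩
  map_add' V W := by ext (i | i) j <;> simp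
  map_smul' r V := by ext (i | i) j <;> simp

/-- The lower rows projection between the kernels of Sylvester operators. -/
def kerSylvesterSnd (A : Matrix n n R) (B : Matrix m m R) (C : Matrix n m R) :
    LinearMap.ker (sylvester (fromBlocks A C 0 B) B) →ₗ[R]
      LinearMap.ker (sylvester B B) where
  toFun Z := ⟨toRows₂ Z.1, by
    have h := Z.2
    rw [← fromRows_toRows Z.1, fromRows_mem_ker_sylvester] at h
    exact mem_ker_sylvester.2 h.2⟩
  map_add' V W := rfl
  map_smul' r V := rfl

lemma kerSylvesterInl_injective (A : Matrix n n R) (B : Matrix m m R) (C : Matrix n m R) :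
    Function.Injective (kerSylvesterInl A B C) := fun _ _ h ↦
  Subtype.ext (fromRows_inj (congrArg Subtype.val h)).1

lemma exact_kerSylvester (A : Matrix n n R) (B : Matrix m m R) (C : Matrix n m R) :
    Function.Exact (kerSylvesterInl A B C) (kerSylvesterSnd A B C) := by
  intro Z
  constructor
  · intro h
    have h₂ : toRows₂ Z.1 = 0 := congrArg Subtype.val h
    have hZ := Z.2
    rw [← fromRows_toRows Z.1, fromRows_mem_ker_sylvester, h₂] at hZ
    refine ⟨⟨toRows₁ Z.1, mem_ker_sylvester.2 (by simpa using hZ.1)⟩, Subtype.ext ?_⟩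
    change fromRows (toRows₁ Z.1) 0 = Z.1
    rw [← h₂, fromRows_toRows]
  · rintro ⟨V, rfl⟩
    rfl

lemma length_ker_sylvester (A : Matrix n n R) (B : Matrix m m R) (C : Matrix n m R) :
    Module.length R (LinearMap.ker (sylvester (fromBlocks A C 0 B) B)) =
      Module.length R (LinearMap.ker (sylvester A B)) +
        Module.length R (LinearMap.range (kerSylvesterSnd A B C)) := by
  refine Module.length_eq_add_of_exact (kerSylvesterInl A B C)
    (kerSylvesterSnd A B C).rangeRestrict (kerSylvesterInl_injective A B C)
    (LinearMap.surjective_rangeRestrict _) fun Z ↦ ?_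
  rw [← exact_kerSylvester A B C Z, ← Subtype.coe_inj]
  rfl

lemma range_kerSylvesterSnd_zero (A : Matrix n n R) (B : Matrix m m R) :
    LinearMap.range (kerSylvesterSnd A B 0) = ⊤ :=
  LinearMap.range_eq_top.2 fun Y ↦ ⟨⟨fromRows 0 Y.1, fromRows_mem_ker_sylvester.2
    ⟨by simp, mem_ker_sylvester.1 Y.2⟩⟩, rfl⟩

/-- Intertwining with a matrix in a similarity identifies kernels of Sylvester operators. -/
def kerSylvesterCongr [DecidableEq n] {M N P Q : Matrix n n R} (B : Matrix m m R)
    (hPQ : P * Q = 1) (hQP : Q * P = 1) (h : P * M = N * P) :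
    LinearMap.ker (sylvester M B) ≃ₗ[R] LinearMap.ker (sylvester N B) where
  toFun Z := ⟨P * Z.1, mem_ker_sylvester.2 <| by
    rw [← Matrix.mul_assoc, ← h, Matrix.mul_assoc, mem_ker_sylvester.1 Z.2, Matrix.mul_assoc]⟩
  invFun Z := ⟨Q * Z.1, mem_ker_sylvester.2 <| by
    have h' : M * Q = Q * N := by
      calc M * Q = Q * (P * M) * Q := by rw [← Matrix.mul_assoc, hQP, Matrix.one_mul]
        _ = Q * N := by rw [h, Matrix.mul_assoc, Matrix.mul_assoc, hPQ, Matrix.mul_one]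
    rw [← Matrix.mul_assoc, h', Matrix.mul_assoc, mem_ker_sylvester.1 Z.2, Matrix.mul_assoc]⟩
  map_add' V W := Subtype.ext (Matrix.mul_add _ _ _)
  map_smul' r V := Subtype.ext (Matrix.mul_smul _ _ _)
  left_inv Z := Subtype.ext (by simp [← Matrix.mul_assoc, hQP])
  right_inv Z := Subtype.ext (by simp [← Matrix.mul_assoc, hPQ])

variable [DecidableEq n] [DecidableEq m]

lemma mem_range_sylvester_of_isArtinianRing [IsArtinianRing R] {A : Matrix n n R}
    {B : Matrix m m R} {C : Matrix n m R} {P Q : Matrix (n ⊕ m) (n ⊕ m) R}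
    (hPQ : P * Q = 1) (hQP : Q * P = 1)
    (h : P * fromBlocks A 0 0 B = fromBlocks A C 0 B * P) :
    C ∈ LinearMap.range (sylvester A B) := by
  have hlen := (kerSylvesterCongr B hPQ hQP h).length_eq
  rw [length_ker_sylvester, length_ker_sylvester, range_kerSylvesterSnd_zero,
    Module.length_top] at hlen
  have hrange : LinearMap.range (kerSylvesterSnd A B C) = ⊤ := by
    by_contra hne
    exact (Submodule.length_lt hne).ne
      (WithTop.add_left_cancel Module.length_ne_top hlen).symm
  obtain ⟨Z, hZ⟩ := LinearMap.range_eq_top.1 hrange ⟨1, mem_ker_sylvester.2 (by simp)⟩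
  have h₂ : toRows₂ Z.1 = 1 := congrArg Subtype.val hZ
  have hZ' := Z.2
  rw [← fromRows_toRows Z.1, fromRows_mem_ker_sylvester, h₂, Matrix.mul_one] at hZ'
  refine ⟨-toRows₁ Z.1, ?_⟩
  rw [sylvester_apply, Matrix.neg_mul, ← hZ'.1, Matrix.mul_neg]
  abel

lemma mem_ideal_smul_top {I : Ideal R} {X : Matrix n m R} (h : ∀ i j, X i j ∈ I) :
    X ∈ (I • ⊤ : Submodule R (Matrix n m R)) := by
  rw [matrix_eq_sum_single X]
  refine Submodule.sum_mem _ fun i _ ↦ Submodule.sum_mem _ fun j _ ↦ ?_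
  rw [← mul_one (X i j), ← smul_eq_mul, ← smul_single]
  exact Submodule.smul_mem_smul (h i j) trivial

end Matrix

lemma Ideal.IsMaximal.isArtinianRing_quotient_pow {R : Type*} [CommRing R] [IsNoetherianRing R]
    {I : Ideal R} (hI : I.IsMaximal) (k : ℕ) : IsArtinianRing (R ⧸ I ^ k) := by
  rw [isArtinianRing_iff_isNoetherianRing_krullDimLE_zero]
  refine ⟨inferInstance, .mk₀ fun J hJ ↦ ?_⟩
  have hJ' : (J.comap (Ideal.Quotient.mk (I ^ k))).IsPrime := inferInstance
  have hle : I ^ k ≤ J.comap (Ideal.Quotient.mk (I ^ k)) := fun x hx ↦ by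
    rw [Ideal.mem_comap, Ideal.Quotient.eq_zero_iff_mem.2 hx]
    exact J.zero_mem
  have heq := hI.eq_of_le hJ'.ne_top (hJ'.le_of_pow_le hle)
  have : (J.comap (Ideal.Quotient.mk (I ^ k))).IsMaximal := heq ▸ hI
  rw [← Ideal.map_comap_of_surjective _ Ideal.Quotient.mk_surjective J]
  exact (Ideal.map_eq_top_or_isMaximal_of_surjective _ Ideal.Quotient.mk_surjective
    this).resolve_left (by
      rw [Ideal.map_comap_of_surjective _ Ideal.Quotient.mk_surjective]; exact hJ.ne_top)

lemma Submodule.mem_of_forall_mem_sup_pow_smul {R M : Type*} [CommRing R] [IsNoetherianRing R]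
    [AddCommGroup M] [Module R M] [Module.Finite R M] {N : Submodule R M} {x : M}
    (h : ∀ I : Ideal R, I.IsMaximal → ∀ k : ℕ, x ∈ N ⊔ I ^ k • ⊤) : x ∈ N := by
  rw [← Submodule.Quotient.mk_eq_zero]
  by_contra hx
  obtain ⟨I, hI, hle⟩ := Ideal.exists_le_maximal (LinearMap.ker (LinearMap.toSpanSingleton R _
    (Submodule.Quotient.mk x : M ⧸ N))) (by
      rw [Ne, Ideal.eq_top_iff_one]; simpa using hx)
  have hmem : (Submodule.Quotient.mk x : M ⧸ N) ∈ (⨅ k : ℕ, I ^ k • ⊤ : Submodule R (M ⧸ N)) := by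
    refine (Submodule.mem_iInf _).2 fun k ↦ ?_
    obtain ⟨y, hy, z, hz, rfl⟩ := Submodule.mem_sup.1 (h I hI k)
    have hmap := Submodule.mem_map_of_mem (f := N.mkQ) hz
    rw [Submodule.map_smul''] at hmap
    rw [Submodule.Quotient.mk_add, (Submodule.Quotient.mk_eq_zero N).2 hy, zero_add]
    exact Submodule.smul_mono le_rfl le_top hmap
  obtain ⟨r, hr⟩ := (I.mem_iInf_smul_pow_eq_bot_iff _).1 hmem
  have h₁ : 1 - (r : R) ∈ I := hle (by
    rw [LinearMap.mem_ker, LinearMap.toSpanSingleton_apply, sub_smul, hr, one_smul, sub_self])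
  exact hI.ne_top ((Ideal.eq_top_iff_one I).2 (by simpa using I.add_mem h₁ r.2))

namespace Matrix

variable {R : Type*} [CommRing R] {n m : Type*} [Fintype n] [Fintype m]
  [DecidableEq n] [DecidableEq m]

lemma mem_range_sylvester_of_isNoetherianRing [IsNoetherianRing R] {A : Matrix n n R}
    {B : Matrix m m R} {C : Matrix n m R} {P Q : Matrix (n ⊕ m) (n ⊕ m) R}
    (hPQ : P * Q = 1) (hQP : Q * P = 1)
    (h : P * fromBlocks A 0 0 B = fromBlocks A C 0 B * P) :
    C ∈ LinearMap.range (sylvester A B) := by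
  refine Submodule.mem_of_forall_mem_sup_pow_smul fun I hI k ↦ ?_
  have := hI.isArtinianRing_quotient_pow k
  let f := Ideal.Quotient.mk (I ^ k)
  have hf : C.map f ∈ LinearMap.range (sylvester (A.map f) (B.map f)) := by
    refine mem_range_sylvester_of_isArtinianRing (P := P.map f) (Q := Q.map f) ?_ ?_ ?_
    · rw [← Matrix.map_mul, hPQ, Matrix.map_one _ f.map_zero f.map_one]
    · rw [← Matrix.map_mul, hQP, Matrix.map_one _ f.map_zero f.map_one]
    · simpa [Matrix.map_mul, fromBlocks_map] using congrArg (fun M ↦ M.map f) h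
  obtain ⟨X, hX⟩ := hf
  choose g hg using Ideal.Quotient.mk_surjective (I := I ^ k)
  have hXg : (X.map g).map f = X := by ext i j; exact hg _
  refine Submodule.mem_sup.2 ⟨_, ⟨X.map g, rfl⟩, C - sylvester A B (X.map g), ?_, by abel⟩
  refine mem_ideal_smul_top fun i j ↦ Ideal.Quotient.eq_zero_iff_mem.1 ?_
  have hzero : (C - sylvester A B (X.map g)).map f = 0 := by
    rw [sylvester_apply, Matrix.map_sub f (map_sub f), Matrix.map_sub f (map_sub f),
      Matrix.map_mul, Matrix.map_mul, hXg, ← hX, sylvester_apply, sub_self]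
  exact congrFun₂ hzero i j

lemma exists_map_eq {S T p q : Type*} {f : S → T} {M : Matrix p q T}
    (h : ∀ i j, M i j ∈ Set.range f) : ∃ N : Matrix p q S, N.map f = M := by
  choose g hg using h
  exact ⟨of g, Matrix.ext hg⟩

lemma mem_range_sylvester {A : Matrix n n R}
    {B : Matrix m m R} {C : Matrix n m R} {P Q : Matrix (n ⊕ m) (n ⊕ m) R}
    (hPQ : P * Q = 1) (hQP : Q * P = 1)
    (h : P * fromBlocks A 0 0 B = fromBlocks A C 0 B * P) :
    C ∈ LinearMap.range (sylvester A B) := by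
  obtain ⟨S, f, _, hf, hM, hP, hQ⟩ : ∃ (S : Subalgebra ℤ R) (f : S →+* R), IsNoetherianRing S ∧
      Function.Injective f ∧ (∀ i j, fromBlocks A C 0 B i j ∈ Set.range f) ∧
      (∀ i j, P i j ∈ Set.range f) ∧ ∀ i j, Q i j ∈ Set.range f := by
    let entries (M : Matrix (n ⊕ m) (n ⊕ m) R) : Set R := Set.range fun ij : _ × _ ↦ M ij.1 ij.2
    let s := entries (fromBlocks A C 0 B) ∪ entries P ∪ entries Q
    have hs : s.Finite :=
      ((Set.finite_range _).union (Set.finite_range _)).union (Set.finite_range _)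
    have hrange {x : R} (hx : x ∈ s) : x ∈ Set.range (Algebra.adjoin ℤ s).subtype :=
      ⟨⟨x, Algebra.subset_adjoin hx⟩, rfl⟩
    exact ⟨Algebra.adjoin ℤ s, (Algebra.adjoin ℤ s).subtype,
      isNoetherianRing_of_fg (Subalgebra.fg_def.2 ⟨s, hs, rfl⟩), Subtype.val_injective,
      fun i j ↦ hrange (.inl (.inl ⟨(i, j), rfl⟩)),
      fun i j ↦ hrange (.inl (.inr ⟨(i, j), rfl⟩)), fun i j ↦ hrange (.inr ⟨(i, j), rfl⟩)⟩
  obtain ⟨A, rfl⟩ := exists_map_eq (M := A) fun i j ↦ hM (.inl i) (.inl j)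
  obtain ⟨B, rfl⟩ := exists_map_eq (M := B) fun i j ↦ hM (.inr i) (.inr j)
  obtain ⟨C, rfl⟩ := exists_map_eq (M := C) fun i j ↦ hM (.inl i) (.inr j)
  obtain ⟨P, rfl⟩ := exists_map_eq hP
  obtain ⟨Q, rfl⟩ := exists_map_eq hQ
  have hinj : Function.Injective fun M : Matrix (n ⊕ m) (n ⊕ m) S ↦ M.map f :=
    Matrix.map_injective hf
  obtain ⟨X, rfl⟩ := mem_range_sylvester_of_isNoetherianRing (A := A) (B := B) (C := C)
    (P := P) (Q := Q)
    (hinj (by simpa [Matrix.map_mul, Matrix.map_one] using hPQ))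
    (hinj (by simpa [Matrix.map_mul, Matrix.map_one] using hQP))
    (hinj (by simpa [Matrix.map_mul, fromBlocks_map] using h))
  refine ⟨X.map f, ?_⟩
  simp only [sylvester_apply, Matrix.map_sub f (map_sub f), Matrix.map_mul]

end Matrix

theorem roth_removal_rule {R : Type*} [CommRing R] (n m : ℕ)
    (A : Matrix (Fin n) (Fin n) R) (B : Matrix (Fin m) (Fin m) R)
    (C : Matrix (Fin n) (Fin m) R) :
    IsConj (Matrix.fromBlocks A 0 0 B) (Matrix.fromBlocks A C 0 B) ↔
      ∃ X : Matrix (Fin n) (Fin m) R, A * X - X * B = C := by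
  constructor
  · rintro ⟨P, hP⟩
    exact Matrix.mem_range_sylvester P.mul_inv P.inv_mul hP
  · rintro ⟨X, rfl⟩
    refine ⟨⟨Matrix.fromBlocks 1 (-X) 0 1, Matrix.fromBlocks 1 X 0 1, ?_, ?_⟩, ?_⟩
    · simp [Matrix.fromBlocks_multiply]
    · simp [Matrix.fromBlocks_multiply]
    · simp [SemiconjBy, Matrix.fromBlocks_multiply, neg_add_eq_sub]
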